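/- arXiv:2405.05932 — 2 statements merged into one kernel-verified Lean document; each statement's English description precedes it below -/
import Mathlib

section
/- There exists a primitive isometric embedding of the rank-10 lattice (U ⊕ U(3) ⊕ A2^{⊕3})(−1) into the K3 lattice U^{⊕3} ⊕ E8(−1)^{⊕2}. -/
open Matrix

/-- Gram matrix of the hyperbolic plane `U`. -/
def gramU : Matrix (Fin 2) (Fin 2) ℤ := !![0, 1; 1, 0]

/-- Gram matrix of `U(3)`. -/
def gramU3 : Matrix (Fin 2) (Fin 2) ℤ := !![0, 3; 3, 0]

/-- Gram matrix of the root lattice `A₂`. -/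
def gramA2 : Matrix (Fin 2) (Fin 2) ℤ := !![2, -1; -1, 2]

/-- Gram matrix of the root lattice `E₈` (standard Cartan matrix, Bourbaki numbering). -/
def gramE8 : Matrix (Fin 8) (Fin 8) ℤ :=
  !![ 2,  0, -1,  0,  0,  0,  0,  0;
      0,  2,  0, -1,  0,  0,  0,  0;
     -1,  0,  2, -1,  0,  0,  0,  0;
      0, -1, -1,  2, -1,  0,  0,  0;
      0,  0,  0, -1,  2, -1,  0,  0;
      0,  0,  0,  0, -1,  2, -1,  0;
      0,  0,  0,  0,  0, -1,  2, -1;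
      0,  0,  0,  0,  0,  0, -1,  2]

/-- Rank-22 index type for the K3 lattice `U^{⊕3} ⊕ E₈(-1)^{⊕2}`. -/
abbrev IK3 : Type := (Fin 2 ⊕ Fin 2) ⊕ (Fin 2 ⊕ (Fin 8 ⊕ Fin 8))

/-- Gram matrix of the K3 lattice `U^{⊕3} ⊕ E₈(-1)^{⊕2}`. -/
def gramK3 : Matrix IK3 IK3 ℤ :=
  Matrix.fromBlocks (Matrix.fromBlocks gramU 0 0 gramU) 0 0
    (Matrix.fromBlocks gramU 0 0
      (Matrix.fromBlocks (-gramE8) 0 0 (-gramE8)))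

/-- Rank-10 index type for the lattice `(U ⊕ U(3) ⊕ A₂^{⊕3})(-1)`. -/
abbrev ISrc : Type := (Fin 2 ⊕ Fin 2) ⊕ (Fin 2 ⊕ (Fin 2 ⊕ Fin 2))

/-- Gram matrix of the lattice `(U ⊕ U(3) ⊕ A₂^{⊕3})(-1)`. -/
def gramSrc : Matrix ISrc ISrc ℤ :=
  - (Matrix.fromBlocks (Matrix.fromBlocks gramU 0 0 gramU3) 0 0
      (Matrix.fromBlocks gramA2 0 0 (Matrix.fromBlocks gramA2 0 0 gramA2)))

/-- Coordinates of the simple roots `α₁`, `α₃` of `E₈`, which span a copy of `A₂`. -/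
def rootsA2 : Matrix (Fin 8) (Fin 2) ℤ :=
  !![1, 0; 0, 0; 0, 1; 0, 0; 0, 0; 0, 0; 0, 0; 0, 0]

/-- Coordinates of the simple roots `α₅`, `α₆` of `E₈`, which span a copy of `A₂` orthogonal to
the one given by `rootsA2`. -/
def rootsA2' : Matrix (Fin 8) (Fin 2) ℤ :=
  !![0, 0; 0, 0; 0, 0; 0, 0; 1, 0; 0, 1; 0, 0; 0, 0]

/-- Matrix of the embedding. With `(eᵢ, fᵢ)` the standard bases of the three hyperbolic planes,
`U(-1)` is spanned by `e₁, -f₁`, `U(3)(-1)` by `e₂, e₃ - 3 f₂`, two copies of `A₂(-1)` lie in the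
first `E₈(-1)` and one in the second. -/
def embK3 : Matrix IK3 ISrc ℤ :=
  fromBlocks (fromBlocks !![1, 0; 0, -1] 0 0 !![1, 0; 0, -3]) 0
    (fromBlocks 0 !![0, 1; 0, 0] 0 0)
    (fromBlocks 0 0 (fromRows rootsA2 0) (fromBlocks rootsA2' 0 0 rootsA2))

/-- Matrix of a retraction of `embK3`. -/
def retrK3 : Matrix ISrc IK3 ℤ :=
  fromBlocks (fromBlocks !![1, 0; 0, -1] 0 0 !![1, 0; 0, 0])
    (fromBlocks 0 0 !![0, 0; 1, 0] 0) 0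
    (fromBlocks 0 (fromCols rootsA2ᵀ 0) 0 (fromBlocks rootsA2'ᵀ 0 0 rootsA2ᵀ))

theorem retrK3_mul_embK3 : retrK3 * embK3 = 1 := by
  decide +kernel

theorem transpose_embK3_mul_gramK3_mul_embK3 : embK3ᵀ * (gramK3 * embK3) = gramSrc := by
  decide +kernel

/-- There is a primitive isometric embedding of the rank-10 lattice
`(U ⊕ U(3) ⊕ A₂^{⊕3})(-1)` into the K3 lattice `U^{⊕3} ⊕ E₈(-1)^{⊕2}`. -/
theorem stmt_11 :
    ∃ f : (ISrc → ℤ) →ₗ[ℤ] (IK3 → ℤ),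
      Function.Injective f ∧
      (∀ v w : ISrc → ℤ, f v ⬝ᵥ gramK3.mulVec (f w) = v ⬝ᵥ gramSrc.mulVec w) ∧
      -- primitivity: the cokernel of f is torsion-free
      (∀ (x : IK3 → ℤ) (n : ℤ), n ≠ 0 → n • x ∈ LinearMap.range f →
        x ∈ LinearMap.range f) := by
  have retr (v : ISrc → ℤ) : retrK3 *ᵥ (embK3 *ᵥ v) = v := by
    rw [mulVec_mulVec, retrK3_mul_embK3, one_mulVec]
  refine ⟨embK3.mulVecLin, Function.LeftInverse.injective retr, fun v w => ?_, ?_⟩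
  · simp only [mulVecLin_apply]
    rw [← transpose_embK3_mul_gramK3_mul_embK3, ← mulVec_mulVec, ← mulVec_mulVec,
      dotProduct_mulVec v, vecMul_transpose]
  · rintro x n hn ⟨v, hv⟩
    refine ⟨retrK3 *ᵥ x, smul_right_injective _ hn ?_⟩
    have hv' : v = n • (retrK3 *ᵥ x) := by
      rw [← mulVec_smul, ← hv, mulVecLin_apply, retr]
    simp only [← hv, hv', map_smul]
end

section
/- Let L be the lattice ℤ^13 with the positive-definite symmetric bilinear form given by the Gram matrix G₁₃ with rows [3,−1,−1,1,−1,1,−1,1,0,1,0,1,0], [−1,3,1,−1,1,−1,−1,−1,−1,0,1,−1,1], [−1,1,3,−1,−1,−1,−1,−1,−1,0,1,0,2], [1,−1,−1,3,−1,1,−1,1,0,1,−1,0,−1], [−1,1,−1,−1,3,−1,1,0,1,−1,1,0,0], [1,−1,−1,1,−1,3,1,0,−1,0,−2,0,−1], [−1,−1,−1,−1,1,1,3,0,1,−1,−1,0,−1], [1,−1,−1,1,0,0,0,3,2,1,1,0,0], [0,−1,−1,0,1,−1,1,2,4,1,1,1,−1], [1,0,0,1,−1,0,−1,1,1,3,1,1,−1],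 [0,1,1,−1,1,−2,−1,1,1,1,4,1,1], [1,−1,0,0,0,0,0,0,1,1,1,3,0], [0,1,2,−1,0,−1,−1,0,−1,−1,1,0,4], and let η = e₁ (so (η,η) = 3). Then: (i) L contains no vector w with (w,w) = 1; (ii) the set of vectors v ∈ L with (v,v) = 3 and (v,η) = 1 is finite and has exactly 81 elements. -/
open Matrix

/-- Gram matrix `G₁₃` of the rank-13 positive-definite lattice `L`. -/
def gramL13 : Matrix (Fin 13) (Fin 13) ℤ :=
  !![ 3, -1, -1,  1, -1,  1, -1,  1,  0,  1,  0,  1,  0;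
     -1,  3,  1, -1,  1, -1, -1, -1, -1,  0,  1, -1,  1;
     -1,  1,  3, -1, -1, -1, -1, -1, -1,  0,  1,  0,  2;
      1, -1, -1,  3, -1,  1, -1,  1,  0,  1, -1,  0, -1;
     -1,  1, -1, -1,  3, -1,  1,  0,  1, -1,  1,  0,  0;
      1, -1, -1,  1, -1,  3,  1,  0, -1,  0, -2,  0, -1;
     -1, -1, -1, -1,  1,  1,  3,  0,  1, -1, -1,  0, -1;
      1, -1, -1,  1,  0,  0,  0,  3,  2,  1,  1,  0,  0;
      0, -1, -1,  0,  1, -1,  1,  2,  4,  1,  1,  1, -1;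
      1,  0,  0,  1, -1,  0, -1,  1,  1,  3,  1,  1, -1;
      0,  1,  1, -1,  1, -2, -1,  1,  1,  1,  4,  1,  1;
      1, -1,  0,  0,  0,  0,  0,  0,  1,  1,  1,  3,  0;
      0,  1,  2, -1,  0, -1, -1,  0, -1, -1,  1,  0,  4]

/-- The vector `η = e₁`, of square 3. -/
def η : Fin 13 → ℤ := fun i => if i = 0 then 1 else 0

/-- A square completion of an integral quadratic form: the entry `(c, m, r)` in position `i` stands
for the summand `c * (m * xᵢ + ∑ⱼ rⱼ xᵢ₊₁₊ⱼ) ^ 2`. -/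
abbrev SquareCompletion := List (ℤ × ℤ × List ℤ)

/-- The linear form with coefficients `r` evaluated at `x`. -/
def linearForm (r x : List ℤ) : ℤ := (List.zipWith (· * ·) r x).sum

/-- The value at `x` of the quadratic form described by a square completion. -/
def SquareCompletion.eval : SquareCompletion → List ℤ → ℤ
  | (c, m, r) :: F, t :: x => c * (m * t + linearForm r x) ^ 2 + SquareCompletion.eval F x
  | _, _ => 0

/-- Fincke–Pohst enumeration: the vectors of value at most `B`, paired with their values. In each
coordinate only the six integers closest to the centre of the admissible interval are tried. -/
def SquareCompletion.shortVectors (B : ℤ) : SquareCompletion → List (ℤ × List ℤ)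
  | [] => [(0, [])]
  | (c, m, r) :: F => (SquareCompletion.shortVectors B F).flatMap fun p =>
      ((List.range 6).map fun j : ℕ =>
        let t := -linearForm r p.2 / m - 2 + j
        (c * (m * t + linearForm r p.2) ^ 2 + p.1, t :: p.2)).filter fun p => p.1 ≤ B

/-- The coefficients are positive, and large enough for six candidates per coordinate to suffice. -/
def SquareCompletion.Admissible (B : ℤ) (F : SquareCompletion) : Prop :=
  ∀ f ∈ F, 0 < f.1 ∧ 0 < f.2.1 ∧ B < f.1 * (3 * f.2.1) ^ 2

theorem SquareCompletion.eval_nonneg {B : ℤ} {F : SquareCompletion} (hF : F.Admissible B)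
    (x : List ℤ) : 0 ≤ F.eval x := by
  induction F generalizing x with
  | nil => simp [SquareCompletion.eval]
  | cons f F ih =>
    obtain ⟨c, m, r⟩ := f
    cases x with
    | nil => simp [SquareCompletion.eval]
    | cons t x =>
      have hc := (hF _ List.mem_cons_self).1
      have := ih (fun f hf => hF f (List.mem_cons_of_mem _ hf)) x
      simp only [SquareCompletion.eval]
      positivity

/-- An integer `t` with `|m t + s| < 3 m` is one of six consecutive integers around `-s / m`. -/
theorem exists_offset_of_sq_lt {m s t : ℤ} (hm : 0 < m) (h : (m * t + s) ^ 2 < (3 * m) ^ 2) :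
    ∃ j : ℕ, j < 6 ∧ -s / m - 2 + j = t := by
  obtain ⟨h₁, h₂⟩ := abs_lt_of_sq_lt_sq' h (by positivity)
  have e := Int.mul_ediv_add_emod (-s) m
  have e₁ := Int.emod_nonneg (-s) hm.ne'
  have e₂ := Int.emod_lt_of_pos (-s) hm
  set q := -s / m
  have l : -3 < t - q := by
    by_contra! hq
    nlinarith
  have u : t - q < 4 := by
    by_contra! hq
    nlinarith
  exact ⟨(t - q + 2).toNat, by omega, by omega⟩

theorem SquareCompletion.mem_shortVectors_iff {B : ℤ} (hB : 0 ≤ B) {F : SquareCompletion}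
    (hF : F.Admissible B) (q : ℤ) (x : List ℤ) :
    (q, x) ∈ F.shortVectors B ↔ x.length = F.length ∧ q = F.eval x ∧ q ≤ B := by
  induction F generalizing q x with
  | nil =>
    simp only [SquareCompletion.shortVectors, SquareCompletion.eval, List.mem_singleton,
      Prod.mk.injEq, List.length_nil, List.length_eq_zero_iff]
    constructor
    · rintro ⟨rfl, rfl⟩
      exact ⟨rfl, rfl, hB⟩
    · rintro ⟨rfl, rfl, -⟩
      exact ⟨rfl, rfl⟩
  | cons f F ih =>
    obtain ⟨c, m, r⟩ := f
    have hF' : SquareCompletion.Admissible B F := fun f hf => hF f (List.mem_cons_of_mem _ hf)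
    obtain ⟨hc, hm, hcm⟩ := hF _ List.mem_cons_self
    simp only [SquareCompletion.shortVectors, List.mem_flatMap, List.mem_filter, List.mem_map,
      List.mem_range, decide_eq_true_eq, Prod.exists, Prod.mk.injEq]
    constructor
    · rintro ⟨p, y, hy, ⟨j, -, rfl, rfl⟩, hq⟩
      obtain ⟨hl, rfl, -⟩ := (ih hF' p y).1 hy
      exact ⟨by simp [hl], rfl, hq⟩
    · rintro ⟨hl, rfl, hq⟩
      cases x with
      | nil => simp at hl
      | cons t x =>
        simp only [SquareCompletion.eval] at hq ⊢
        have hx := SquareCompletion.eval_nonneg hF' x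
        have hsq : (m * t + linearForm r x) ^ 2 < (3 * m) ^ 2 := by
          dsimp only at hc hcm
          exact lt_of_mul_lt_mul_left (by linarith) hc.le
        have hp : 0 ≤ c * (m * t + linearForm r x) ^ 2 := mul_nonneg hc.le (sq_nonneg _)
        obtain ⟨j, hj, rfl⟩ := exists_offset_of_sq_lt hm hsq
        exact ⟨SquareCompletion.eval F x, x, (ih hF' _ x).2 ⟨by simpa using hl, rfl, by linarith⟩,
          ⟨j, hj, rfl, rfl⟩, hq⟩

/-- A square completion of `120` times the form `gramL13`. -/
def gramL13Completion : SquareCompletion :=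
  [(40, 3, [-1, -1, 1, -1, 1, -1, 1, 0, 1, 0, 1, 0]),
   (5, 8, [2, -2, 2, -2, -4, -2, -3, 1, 3, -2, 3]),
   (3, 10, [-2, -6, -2, -4, -2, -3, 1, 3, 2, 7]),
   (2, 12, [-4, 2, -6, 2, -2, 4, -3, -2, -2]),
   (10, 4, [-2, 0, 1, 2, -1, 3, 2, 2]),
   (15, 4, [2, -1, -2, -1, -2, 0, 0]),
   (15, 2, [1, 2, 1, 0, 0, 0]),
   (15, 4, [2, 1, 2, -1, 1]),
   (45, 2, [1, 0, 1, -1]),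
   (45, 2, [1, 1, -1]),
   (15, 3, [1, -1]),
   (30, 2, [1]),
   (90, 1, [])]

theorem gramL13Completion_admissible : gramL13Completion.Admissible (3 * 120) := by
  unfold SquareCompletion.Admissible
  decide

theorem eval_gramL13Completion (v : Fin 13 → ℤ) :
    gramL13Completion.eval (List.ofFn v) = 120 * (v ⬝ᵥ gramL13.mulVec v) := by
  simp [gramL13Completion, SquareCompletion.eval, linearForm, List.ofFn_succ, gramL13,
    Matrix.mulVec, dotProduct, Fin.sum_univ_succ]
  ring

theorem dotProduct_gramL13_η (v : Fin 13 → ℤ) :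
    v ⬝ᵥ gramL13.mulVec η =
      linearForm [3, -1, -1, 1, -1, 1, -1, 1, 0, 1, 0, 1, 0] (List.ofFn v) := by
  simp [linearForm, List.ofFn_succ, gramL13, η, Matrix.mulVec, dotProduct, Fin.sum_univ_succ]
  ring

theorem mem_shortVectors_gramL13Completion_iff (q : ℤ) (v : Fin 13 → ℤ) :
    (q, List.ofFn v) ∈ gramL13Completion.shortVectors (3 * 120) ↔
      q = 120 * (v ⬝ᵥ gramL13.mulVec v) ∧ q ≤ 3 * 120 := by
  rw [SquareCompletion.mem_shortVectors_iff (by norm_num) gramL13Completion_admissible,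
    eval_gramL13Completion]
  simp [gramL13Completion]

/-- The coordinate lists of the vectors of square 3 having product 1 with `η`. -/
def squareThreeVectors : List (List ℤ) :=
  ((gramL13Completion.shortVectors (3 * 120)).filter fun p =>
    p.1 = 3 * 120 ∧ linearForm [3, -1, -1, 1, -1, 1, -1, 1, 0, 1, 0, 1, 0] p.2 = 1).map Prod.snd

theorem mem_squareThreeVectors_iff (v : Fin 13 → ℤ) :
    List.ofFn v ∈ squareThreeVectors ↔ v ⬝ᵥ gramL13.mulVec v = 3 ∧ v ⬝ᵥ gramL13.mulVec η = 1 := by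
  simp only [squareThreeVectors, List.mem_map, List.mem_filter, decide_eq_true_eq, Prod.exists,
    exists_eq_right, mem_shortVectors_gramL13Completion_iff, ← dotProduct_gramL13_η]
  constructor
  · rintro ⟨q, ⟨h, -⟩, rfl, hη⟩
    exact ⟨by omega, hη⟩
  · rintro ⟨h, hη⟩
    exact ⟨3 * 120, ⟨by omega, le_rfl⟩, rfl, hη⟩

theorem length_of_mem_squareThreeVectors {x : List ℤ} (hx : x ∈ squareThreeVectors) :
    x.length = 13 := by
  simp only [squareThreeVectors, List.mem_map, List.mem_filter, Prod.exists, exists_eq_right] at hx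
  obtain ⟨q, hq, -⟩ := hx
  exact ((SquareCompletion.mem_shortVectors_iff (by norm_num) gramL13Completion_admissible
    q x).1 hq).1

theorem image_ofFn_squareThreeVectors :
    Set.image List.ofFn
        {v : Fin 13 → ℤ | v ⬝ᵥ gramL13.mulVec v = 3 ∧ v ⬝ᵥ gramL13.mulVec η = 1} =
      (squareThreeVectors.toFinset : Set (List ℤ)) := by
  ext x
  simp only [Set.mem_image, Set.mem_ofPred_eq, List.coe_toFinset, ← mem_squareThreeVectors_iff]
  constructor
  · rintro ⟨v, hv, rfl⟩
    exact hv
  · intro hx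
    have hl := length_of_mem_squareThreeVectors hx
    obtain ⟨v, rfl⟩ : ∃ v : Fin 13 → ℤ, List.ofFn v = x :=
      ⟨fun i => x.get (i.cast hl.symm), List.ext_getElem (by simp [hl])
        fun i _ _ => by rw [List.getElem_ofFn]; rfl⟩
    exact ⟨v, hx, rfl⟩

theorem forall_mem_shortVectors_gramL13Completion :
    ∀ p ∈ gramL13Completion.shortVectors (3 * 120), p.1 ≠ 120 := by
  decide +kernel

theorem squareThreeVectors_nodup : squareThreeVectors.Nodup := by
  decide +kernel

theorem length_squareThreeVectors : squareThreeVectors.length = 81 := by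
  decide +kernel

/-- In the lattice `L = (ℤ¹³, G₁₃)` with `η = e₁`:
(i) there is no vector of square 1;
(ii) there are exactly 81 vectors `v` with `(v,v) = 3` and `(v,η) = 1`. -/
theorem stmt_14 :
    (∀ w : Fin 13 → ℤ, w ⬝ᵥ gramL13.mulVec w ≠ 1) ∧
    ({v : Fin 13 → ℤ | v ⬝ᵥ gramL13.mulVec v = 3 ∧ v ⬝ᵥ gramL13.mulVec η = 1}.Finite ∧
      {v : Fin 13 → ℤ | v ⬝ᵥ gramL13.mulVec v = 3 ∧ v ⬝ᵥ gramL13.mulVec η = 1}.ncard = 81) := by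
  refine ⟨fun w hw => ?_, ?_, ?_⟩
  · exact forall_mem_shortVectors_gramL13Completion _
      ((mem_shortVectors_gramL13Completion_iff 120 w).2 ⟨by rw [hw]; rfl, by norm_num⟩) rfl
  · refine Set.Finite.of_finite_image ?_ List.ofFn_injective.injOn
    rw [image_ofFn_squareThreeVectors]
    exact Finset.finite_toSet _
  · rw [← Set.ncard_image_of_injective _ List.ofFn_injective, image_ofFn_squareThreeVectors,
      Set.ncard_coe_finset, List.toFinset_card_of_nodup squareThreeVectors_nodup,
      length_squareThreeVectors]
end
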